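/- For every ε > 0 there exists N₀ such that for all N > N₀ and every finite seed set 𝒮 with 1 ≤ log₂|𝒮| < N/12, if G : 𝒮 → {-1,1}^N is a random generator whose entries e_n(s), for s ∈ 𝒮 and 1 ≤ n ≤ N, are independent uniform ±1 random variables, then with probability at least 1 - ε one has (2/5)·√(N·(log C(N,k) + k·log|𝒮|)) < Φ̃_k(G) < (5/2)·√(N·(log C(N,k) + k·log|𝒮|)) simultaneously for every integer k with 2 ≤ k ≤ N/(6·log₂|𝒮|). -/

import Mathlib

/-- The value `±1` associated to a Boolean. -/
def pmVal (b : Bool) : ℤ := if b then 1 else -1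

/-- Entry of a binary sequence `E ∈ {-1,1}^N` at (0-based) position `t`,
defaulting to `1` out of range. -/
def seqAt {N : ℕ} (E : Fin N → Bool) (t : ℕ) : ℤ :=
  if h : t < N then pmVal (E ⟨t, h⟩) else 1

/-- Set of values `|V_{k₁,…,k_ℓ}(E_N(s₁),…,E_N(s_ℓ),M,D)|` over all admissible
parameters: `ℓ ≥ 1`, `k₁,…,k_ℓ ≥ 1` with `k₁ + … + k_ℓ = k`, distinct seeds
`s₁,…,s_ℓ`, `1 ≤ M`, and shifts `0 ≤ dⁱ₁ < … < dⁱ_{kᵢ}` with `M + dⁱ_{kᵢ} ≤ N`. -/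
def genCorrSet {S : Type*} {N : ℕ} (k : ℕ) (G : S → Fin N → Bool) : Set ℕ :=
  {v | ∃ (ℓ : ℕ) (κ : Fin ℓ → ℕ) (s : Fin ℓ → S) (M : ℕ)
        (d : (i : Fin ℓ) → Fin (κ i) → ℕ),
      1 ≤ ℓ ∧ (∀ i, 1 ≤ κ i) ∧ (∑ i, κ i) = k ∧ Function.Injective s ∧
      1 ≤ M ∧ (∀ i, StrictMono (d i)) ∧ (∀ i j, M + d i j ≤ N) ∧
      v = (∑ n ∈ Finset.range M, ∏ i, ∏ j, seqAt (G (s i)) (n + d i j)).natAbs}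

/-- The cross-correlation measure `Φ̃ₖ(G)` of order `k` of a generator
`G : 𝒮 → {-1,1}^N`. -/
noncomputable def genCrossCorr {S : Type*} {N : ℕ} (k : ℕ) (G : S → Fin N → Bool) : ℕ :=
  sSup (genCorrSet k G)

/-- The sign character of `ZMod 2`, with integer values. -/
def signChar (z : ZMod 2) : ℤ := if z = 0 then 1 else -1

lemma signChar_add : ∀ a b : ZMod 2, signChar (a + b) = signChar a * signChar b := by
  decide

lemma signChar_sum {ι : Type*} (T : Finset ι) (f : ι → ZMod 2) :
    signChar (∑ p ∈ T, f p) = ∏ p ∈ T, signChar (f p) := by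
  classical
  induction T using Finset.induction_on with
  | empty => simp [signChar]
  | insert a T ha ih => rw [Finset.sum_insert ha, Finset.prod_insert ha, signChar_add, ih]

/-- Extension by zero of a binary word. -/
def zeroExtend {N : ℕ} (x : Fin N → ZMod 2) (t : ℕ) : ZMod 2 :=
  if h : t < N then x ⟨t, h⟩ else 0

/-- For each `q`, the sums over `Q q` of the letters of the words `x s`, shifted by `n < M`. -/
def shiftMap {S R : Type*} (N M : ℕ) (Q : R → Finset (S × ℕ)) :
    (S → Fin N → ZMod 2) →ₗ[ZMod 2] (R × Fin M → ZMod 2) where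
  toFun x qn := ∑ p ∈ Q qn.1, zeroExtend (x p.1) (qn.2 + p.2)
  map_add' x y := by
    ext qn
    simp only [Pi.add_apply, ← Finset.sum_add_distrib]
    refine Finset.sum_congr rfl fun p _ => ?_
    unfold zeroExtend
    split_ifs <;> simp
  map_smul' c x := by
    ext qn
    simp only [Pi.smul_apply, Finset.smul_sum, RingHom.id_apply]
    refine Finset.sum_congr rfl fun p _ => ?_
    unfold zeroExtend
    split_ifs <;> simp

open Classical in
/-- The generating polynomial over `ZMod 2` of the shifts attached to the seed `s`. -/
noncomputable def seedPoly {S : Type*} (T : Finset (S × ℕ)) (s : S) : Polynomial (ZMod 2) :=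
  ∑ p ∈ T, if p.1 = s then Polynomial.X ^ p.2 else 0

lemma coeff_seedPoly {S : Type*} (T : Finset (S × ℕ)) (s : S) (t : ℕ) [Decidable ((s, t) ∈ T)] :
    (seedPoly T s).coeff t = if (s, t) ∈ T then 1 else 0 := by
  classical
  rw [seedPoly, Polynomial.finsetSum_coeff]
  have h : ∀ p ∈ T, (if p.1 = s then (Polynomial.X : Polynomial (ZMod 2)) ^ p.2 else 0).coeff t
      = if p = (s, t) then 1 else 0 := by
    rintro ⟨a, b⟩ _
    by_cases ha : a = s
    · simp [ha, Polynomial.coeff_X_pow, eq_comm]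
    · simp [ha]
  rw [Finset.sum_congr rfl h, Finset.sum_ite_eq']
  congr

lemma seedPoly_injective {S : Type*} {T T' : Finset (S × ℕ)}
    (h : ∀ s, seedPoly T s = seedPoly T' s) : T = T' := by
  classical
  ext ⟨s, t⟩
  have := congrArg (fun P => P.coeff t) (h s)
  simp only [coeff_seedPoly] at this
  by_cases h1 : (s, t) ∈ T <;> by_cases h2 : (s, t) ∈ T' <;> simp_all

theorem shiftMap_surjective {S R : Type*} [Fintype R] {N M : ℕ}
    (Q : R → Finset (S × ℕ)) (hQ : ∀ q, ∀ p ∈ Q q, M + p.2 ≤ N)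
    (hind : ∀ a : R → Polynomial (ZMod 2),
      (∀ s, ∑ q, a q * seedPoly (Q q) s = 0) → ∀ q, a q = 0) :
    Function.Surjective (shiftMap N M Q) := by
  classical
  rw [← LinearMap.dualMap_injective_iff, injective_iff_map_eq_zero]
  intro φ hφ
  have hφ' : ∀ x, φ (shiftMap N M Q x) = 0 := fun x => by
    have := LinearMap.congr_fun hφ x
    simpa using this
  set c : R × Fin M → ZMod 2 := fun i => φ (fun j => if i = j then 1 else 0) with hc
  have hφc : ∀ v, φ v = ∑ i, v i * c i := fun v => by
    rw [LinearMap.pi_apply_eq_sum_univ φ v]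
    simp [hc]
  set a : R → Polynomial (ZMod 2) := fun q =>
    ∑ n : Fin M, Polynomial.C (c (q, n)) * Polynomial.X ^ (n : ℕ) with ha
  have key : ∀ s, ∑ q, a q * seedPoly (Q q) s = 0 := by
    intro s
    ext t
    have h1 := hφ' (fun s' t' => if s' = s ∧ (t' : ℕ) = t then 1 else 0)
    rw [hφc, Fintype.sum_prod_type] at h1
    rw [Polynomial.finsetSum_coeff, Polynomial.coeff_zero, ← h1]
    refine Finset.sum_congr rfl fun q _ => ?_
    rw [ha]
    simp only [seedPoly]
    rw [Finset.sum_mul, Polynomial.finsetSum_coeff]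
    refine Finset.sum_congr rfl fun n _ => ?_
    rw [mul_assoc, Polynomial.coeff_C_mul, mul_comm, Finset.mul_sum, Polynomial.finsetSum_coeff]
    congr 1
    simp only [shiftMap, LinearMap.coe_mk, AddHom.coe_mk]
    refine Finset.sum_congr rfl fun p hp => ?_
    have hlt : (n : ℕ) + p.2 < N := by
      have := hQ q p hp
      omega
    simp only [zeroExtend, hlt, dif_pos]
    by_cases hs : p.1 = s
    · simp [hs, ← pow_add, Polynomial.coeff_X_pow, eq_comm]
    · simp [hs]
  have h0 := hind a key
  have hc0 : ∀ i, c i = 0 := by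
    rintro ⟨q, n⟩
    have := congrArg (fun P => P.coeff (n : ℕ)) (h0 q)
    simpa [ha, Polynomial.finsetSum_coeff, Polynomial.coeff_X_pow, Fin.val_inj] using this
  ext v
  simp [hφc, hc0]

theorem shiftMap_unit_surjective {S : Type*} {N M : ℕ} {T : Finset (S × ℕ)}
    (hT : T.Nonempty) (hQ : ∀ p ∈ T, M + p.2 ≤ N) :
    Function.Surjective (shiftMap (R := Unit) N M fun _ => T) := by
  refine shiftMap_surjective _ (fun _ => hQ) fun a h q => ?_
  by_contra ha
  have : T = ∅ := seedPoly_injective fun s => by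
    have h1 := h s
    simp only [Finset.univ_unique, Finset.sum_singleton, mul_eq_zero] at h1
    rcases h1 with h1 | h1
    · exact absurd h1 ha
    · rw [h1]; simp [seedPoly]
  exact hT.ne_empty this

theorem shiftMap_bool_surjective {S : Type*} {N M : ℕ} {T T' : Finset (S × ℕ)} (s₀ : S)
    (hne : T ≠ T') (hT : ∀ p ∈ T, M + p.2 ≤ N) (hT' : ∀ p ∈ T', M + p.2 ≤ N)
    (hs : seedPoly T s₀ = 1) (hs' : seedPoly T' s₀ = 1) :
    Function.Surjective (shiftMap N M fun b : Bool => if b then T else T') := by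
  refine shiftMap_surjective _ (fun b => by cases b <;> assumption) fun a h => ?_
  simp only [Fintype.sum_bool, if_true, Bool.false_eq_true, if_false] at h
  have h1 : a false = - a true := by
    have := h s₀
    rw [hs, hs', mul_one, mul_one] at this
    linear_combination this
  have h2 : a true = 0 := by
    by_contra h3
    refine hne (seedPoly_injective fun s => ?_)
    have := h s
    rw [h1] at this
    exact mul_left_cancel₀ h3 (by linear_combination this)
  rintro (_ | _)
  · simp [h1, h2]
  · exact h2

lemma card_mul_sum_comp_of_surjective {W V : Type*} [AddCommGroup W] [Fintype W]
    [AddCommGroup V] [Fintype V] (f : W →+ V) (hf : Function.Surjective f) (g : V → ℝ) :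
    (Fintype.card V : ℝ) * ∑ x, g (f x) = Fintype.card W * ∑ v, g v := by
  classical
  have hfib : ∀ v, (Finset.univ.filter fun x => f x = v).card
      = (Finset.univ.filter fun x => f x = 0).card := fun v =>
    AddMonoidHom.card_fiber_eq_of_mem_range f (hf v) (hf 0)
  set c := (Finset.univ.filter fun x => f x = 0).card
  have hW : Fintype.card W = Fintype.card V * c := by
    rw [← Finset.card_univ, Finset.card_eq_sum_card_fiberwise (f := f) (t := Finset.univ)
      (fun _ _ => Finset.mem_univ _), Finset.sum_congr rfl fun v _ => hfib v]
    simp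
  have hsum : ∑ x, g (f x) = c * ∑ v, g v := by
    rw [← Finset.sum_fiberwise (s := Finset.univ) (g := f), Finset.mul_sum]
    refine Finset.sum_congr rfl fun v _ => ?_
    rw [Finset.sum_congr rfl (g := fun _ => g v) (fun x hx => by
      rw [(Finset.mem_filter.1 hx).2]), Finset.sum_const, nsmul_eq_mul, hfib v]
  rw [hsum, hW]
  push_cast
  ring

/-- The sum of the signs of a binary word. -/
def signSum {M : ℕ} (v : Fin M → ZMod 2) : ℤ := ∑ n, signChar (v n)

lemma sum_exp_signSum (M : ℕ) (t : ℝ) :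
    ∑ v : Fin M → ZMod 2, Real.exp (t * signSum v) = (2 * Real.cosh t) ^ M := by
  have h1 : ∀ v : Fin M → ZMod 2,
      Real.exp (t * signSum v) = ∏ n, Real.exp (t * signChar (v n)) := fun v => by
    rw [← Real.exp_sum, signSum]
    push_cast
    rw [Finset.mul_sum]
  simp_rw [h1]
  rw [← Fintype.prod_sum (f := fun (_ : Fin M) (z : ZMod 2) => Real.exp (t * signChar z))]
  have h2 : ∑ z : ZMod 2, Real.exp (t * signChar z) = 2 * Real.cosh t := by
    rw [show (Finset.univ : Finset (ZMod 2)) = {0, 1} from rfl, Finset.sum_pair (by decide),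
      Real.cosh_eq]
    simp [signChar]
    ring
  simp [h2]

open Classical in
lemma card_signSum_ge_le {M : ℕ} (hM : 0 < M) {r : ℝ} (hr : 0 ≤ r) :
    ((Finset.univ.filter fun v : Fin M → ZMod 2 => r ≤ |(signSum v : ℝ)|).card : ℝ)
      ≤ 2 * 2 ^ M * Real.exp (-(r ^ 2 / (2 * M))) := by
  have hM' : (0 : ℝ) < M := by exact_mod_cast hM
  set t : ℝ := r / M with ht
  have ht0 : 0 ≤ t := by positivity
  have h1 : ∀ v : Fin M → ZMod 2, (if r ≤ |(signSum v : ℝ)| then (1 : ℝ) else 0) ≤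
      Real.exp (-(t * r)) * (Real.exp (t * signSum v) + Real.exp (-t * signSum v)) := by
    intro v
    split_ifs with h
    · rw [mul_add, ← Real.exp_add, ← Real.exp_add]
      rcases le_abs.1 h with h | h
      · have : 1 ≤ Real.exp (-(t * r) + t * signSum v) :=
          Real.one_le_exp (by nlinarith)
        linarith [Real.exp_pos (-(t * r) + -t * signSum v)]
      · have : 1 ≤ Real.exp (-(t * r) + -t * signSum v) :=
          Real.one_le_exp (by nlinarith)
        linarith [Real.exp_pos (-(t * r) + t * signSum v)]
    · positivity
  calc ((Finset.univ.filter fun v : Fin M → ZMod 2 => r ≤ |(signSum v : ℝ)|).card : ℝ)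
      = ∑ v : Fin M → ZMod 2, if r ≤ |(signSum v : ℝ)| then (1 : ℝ) else 0 := by
        rw [Finset.sum_boole]
    _ ≤ ∑ v : Fin M → ZMod 2,
        Real.exp (-(t * r)) * (Real.exp (t * signSum v) + Real.exp (-t * signSum v)) :=
        Finset.sum_le_sum fun v _ => h1 v
    _ = Real.exp (-(t * r)) * (2 * (2 * Real.cosh t) ^ M) := by
        rw [← Finset.mul_sum, Finset.sum_add_distrib, sum_exp_signSum, sum_exp_signSum,
          Real.cosh_neg]
        ring
    _ ≤ Real.exp (-(t * r)) * (2 * (2 * Real.exp (t ^ 2 / 2)) ^ M) := by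
        gcongr
        · exact Real.cosh_le_exp_half_sq t
    _ = 2 * 2 ^ M * Real.exp (-(r ^ 2 / (2 * M))) := by
        rw [mul_pow, ← Real.exp_nat_mul]
        rw [show -(r ^ 2 / (2 * M)) = -(t * r) + M * (t ^ 2 / 2) by rw [ht]; field_simp; ring,
          Real.exp_add]
        ring

open Classical in
lemma choose_le_card_signSum_ge (m j : ℕ) :
    (2 * m).choose (m + j) ≤
      (Finset.univ.filter fun v : Fin (2 * m) → ZMod 2 => (2 * j : ℤ) ≤ signSum v).card := by
  have h0 : (Finset.powersetCard (m + j) (Finset.univ : Finset (Fin (2 * m)))).card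
      = (2 * m).choose (m + j) := by simp
  rw [← h0]
  refine Finset.card_le_card_of_injOn (fun A n => if n ∈ A then 0 else 1) ?_ ?_
  · intro A hA
    have hA' : A.card = m + j := (Finset.mem_powersetCard.1 hA).2
    simp only [Finset.coe_filter, Finset.mem_univ, true_and, Set.mem_ofPred_eq]
    have h1 : ∀ n, signChar (if n ∈ A then 0 else 1) = 2 * (if n ∈ A then 1 else 0) - 1 := by
      intro n
      split_ifs <;> simp [signChar]
    simp only [signSum, h1, Finset.sum_sub_distrib, ← Finset.mul_sum]
    simp [hA']
    omega
  · intro A _ B _ h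
    ext n
    have := congrFun h n
    by_cases h1 : n ∈ A <;> by_cases h2 : n ∈ B <;> simp_all

/-- Second moment method for pairwise independent events of equal probability `p`. -/
lemma card_avoid_le {W ι : Type*} [Fintype W] (F : Finset ι) (f : ι → W → ℝ) {p : ℝ}
    (h01 : ∀ i ∈ F, ∀ x, f i x = 0 ∨ f i x = 1)
    (h1 : ∀ i ∈ F, ∑ x, f i x = p * Fintype.card W)
    (h2 : ∀ i ∈ F, ∀ j ∈ F, i ≠ j → ∑ x, f i x * f j x = p ^ 2 * Fintype.card W)
    (hp : 0 < p) (hF : F.Nonempty) (B : Finset W) (hB : ∀ x ∈ B, ∀ i ∈ F, f i x = 0) :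
    (B.card : ℝ) ≤ Fintype.card W / (F.card * p) := by
  classical
  have hF' : (0 : ℝ) < F.card := by exact_mod_cast hF.card_pos
  set w : ℝ := (Fintype.card W : ℝ) with hw
  have hw0 : 0 ≤ w := by positivity
  set μ : ℝ := F.card * p with hμ
  have hμ0 : 0 < μ := by positivity
  have e1 : ∑ x, ∑ i ∈ F, f i x = μ * w := by
    rw [Finset.sum_comm, Finset.sum_congr rfl h1, Finset.sum_const, nsmul_eq_mul]
    ring
  have e2 : ∑ x, (∑ i ∈ F, f i x) ^ 2 ≤ (μ + μ ^ 2) * w := by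
    calc ∑ x, (∑ i ∈ F, f i x) ^ 2 = ∑ i ∈ F, ∑ j ∈ F, ∑ x, f i x * f j x := by
          simp_rw [sq, Finset.sum_mul_sum]
          rw [Finset.sum_comm]
          exact Finset.sum_congr rfl fun i _ => Finset.sum_comm
      _ ≤ ∑ i ∈ F, ∑ j ∈ F, (p ^ 2 * w + if i = j then p * w else 0) := by
          refine Finset.sum_le_sum fun i hi => Finset.sum_le_sum fun j hj => ?_
          by_cases hij : i = j
          · subst hij
            have : ∀ x, f i x * f i x = f i x := fun x => by
              rcases h01 i hi x with h | h <;> simp [h]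
            simp only [this, h1 i hi, if_true]
            have : 0 ≤ p ^ 2 * w := by positivity
            linarith
          · simp [hij, h2 i hi j hj hij]
      _ = (μ + μ ^ 2) * w := by
          simp [Finset.sum_add_distrib, Finset.sum_ite_eq, hμ]
          ring
  have e3 : (B.card : ℝ) * μ ^ 2 ≤ ∑ x, (∑ i ∈ F, f i x - μ) ^ 2 := by
    calc (B.card : ℝ) * μ ^ 2 = ∑ x ∈ B, (∑ i ∈ F, f i x - μ) ^ 2 := by
          rw [Finset.sum_congr rfl (g := fun _ => μ ^ 2) (fun x hx => by
            rw [Finset.sum_eq_zero (hB x hx)]; ring), Finset.sum_const, nsmul_eq_mul]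
      _ ≤ _ := Finset.sum_le_univ_sum_of_nonneg fun x => sq_nonneg _
  have e4 : ∑ x, (∑ i ∈ F, f i x - μ) ^ 2 =
      ∑ x, (∑ i ∈ F, f i x) ^ 2 - 2 * μ * ∑ x, ∑ i ∈ F, f i x + w * μ ^ 2 := by
    simp only [sub_sq, Finset.sum_add_distrib, Finset.sum_sub_distrib, Finset.mul_sum]
    simp only [Finset.sum_mul, Finset.sum_const, Finset.card_univ, nsmul_eq_mul, hw]
    congr 2
    exact Finset.sum_congr rfl fun x _ => Finset.sum_congr rfl fun i _ => by ring
  rw [le_div_iff₀ hμ0]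
  rw [e4, e1] at e3
  have : (B.card : ℝ) * μ * μ ≤ w * μ := by nlinarith
  exact le_of_mul_le_mul_right this hμ0

/-- The identification of `Bool` with `ZMod 2` under which `pmVal` becomes `signChar`. -/
def boolEquivZMod : Bool ≃ ZMod 2 where
  toFun b := if b then 0 else 1
  invFun z := decide (z = 0)
  left_inv := by decide
  right_inv := by decide

/-- Generators as families of words over `ZMod 2`. -/
def genEquiv (S : Type*) (N : ℕ) : (S → Fin N → Bool) ≃ (S → Fin N → ZMod 2) :=
  Equiv.piCongrRight fun _ => Equiv.piCongrRight fun _ => boolEquivZMod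

lemma seqAt_eq_signChar {S : Type*} {N : ℕ} (G : S → Fin N → Bool) (s : S) (t : ℕ) :
    seqAt (G s) t = signChar (zeroExtend (genEquiv S N G s) t) := by
  have h : ∀ b, pmVal b = signChar (boolEquivZMod b) := by decide
  unfold seqAt zeroExtend
  split_ifs
  · exact h _
  · rfl

/-- The correlation sum attached to a set `T` of pairs (seed, shift). -/
def corrSum {S : Type*} {N : ℕ} (T : Finset (S × ℕ)) (M : ℕ) (G : S → Fin N → Bool) : ℤ :=
  ∑ n ∈ Finset.range M, ∏ p ∈ T, seqAt (G p.1) (n + p.2)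

/-- The word over `ZMod 2` whose sign sum is `corrSum T M G`. -/
def corrWord {S : Type*} {N : ℕ} (T : Finset (S × ℕ)) (M : ℕ) (G : S → Fin N → Bool) :
    Fin M → ZMod 2 :=
  fun n => ∑ p ∈ T, zeroExtend (genEquiv S N G p.1) (n + p.2)

lemma corrSum_eq_signSum {S : Type*} {N : ℕ} (T : Finset (S × ℕ)) (M : ℕ)
    (G : S → Fin N → Bool) : corrSum T M G = signSum (corrWord T M G) := by
  rw [corrSum, Finset.sum_range, signSum]
  refine Finset.sum_congr rfl fun n _ => ?_
  rw [corrWord, signChar_sum]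
  exact Finset.prod_congr rfl fun p _ => seqAt_eq_signChar _ _ _

lemma sum_prod_corrWord {S R : Type*} [Fintype S] [DecidableEq S] [Fintype R] [DecidableEq R]
    {N M : ℕ} (Q : R → Finset (S × ℕ)) (hQ : Function.Surjective (shiftMap N M Q))
    (h : R → (Fin M → ZMod 2) → ℝ) :
    (2 ^ M : ℝ) ^ Fintype.card R * ∑ G : S → Fin N → Bool, ∏ q, h q (corrWord (Q q) M G) =
      Fintype.card (S → Fin N → Bool) * ∏ q, ∑ v, h q v := by
  have h1 := card_mul_sum_comp_of_surjective (shiftMap N M Q).toAddMonoidHom hQ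
    fun v => ∏ q, h q (fun n => v (q, n))
  rw [← Equiv.sum_comp (genEquiv S N), Fintype.card_congr (genEquiv S N).symm] at h1
  have h2 : ∑ v : R × Fin M → ZMod 2, ∏ q, h q (fun n => v (q, n)) = ∏ q, ∑ v, h q v := by
    rw [Fintype.prod_sum]
    exact Equiv.sum_comp (Equiv.curry R (Fin M) (ZMod 2)) fun u => ∏ q, h q (u q)
  rw [h2] at h1
  have h3 : (Fintype.card (R × Fin M → ZMod 2) : ℝ) = (2 ^ M : ℝ) ^ Fintype.card R := by
    simp [ZMod.card, ← pow_mul, mul_comm]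
  rw [h3] at h1
  exact h1

open Classical in
lemma card_corrSum_ge_le {S : Type*} [Fintype S] {N M : ℕ} (hM : 0 < M) {T : Finset (S × ℕ)}
    (hT : T.Nonempty) (hTN : ∀ p ∈ T, M + p.2 ≤ N) {r : ℝ} (hr : 0 ≤ r) :
    ((Finset.univ.filter fun G : S → Fin N → Bool => r ≤ |(corrSum T M G : ℝ)|).card : ℝ) ≤
      Fintype.card (S → Fin N → Bool) * (2 * Real.exp (-(r ^ 2 / (2 * M)))) := by
  have h1 := sum_prod_corrWord _ (shiftMap_unit_surjective hT hTN)
    fun _ v => if r ≤ |(signSum v : ℝ)| then 1 else 0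
  simp only [Finset.univ_unique, Finset.prod_singleton, Fintype.card_unit, pow_one,
    ← corrSum_eq_signSum, Finset.sum_boole] at h1
  have h2 := card_signSum_ge_le hM hr
  have h3 : (0 : ℝ) < 2 ^ M := by positivity
  refine le_of_mul_le_mul_left ?_ h3
  rw [h1]
  calc _ ≤ _ := mul_le_mul_of_nonneg_left h2 (Nat.cast_nonneg _)
    _ = _ := by ring

lemma natAbs_corrSum_le {S : Type*} {N : ℕ} (T : Finset (S × ℕ)) (M : ℕ) (G : S → Fin N → Bool) :
    (corrSum T M G).natAbs ≤ M := by
  rw [corrSum_eq_signSum]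
  have h : ∀ z, (signChar z).natAbs = 1 := by decide
  calc (signSum (corrWord T M G)).natAbs ≤ ∑ n : Fin M, (signChar (corrWord T M G n)).natAbs :=
        Int.natAbs_sum_le _ _
    _ = M := by simp [h]

lemma natAbs_corrSum_mem {S : Type*} {N k M : ℕ} (G : S → Fin N → Bool) {T : Finset (S × ℕ)}
    (hk : 1 ≤ k) (hT : T.card = k) (hM : 1 ≤ M) (hTN : ∀ p ∈ T, M + p.2 ≤ N) :
    (corrSum T M G).natAbs ∈ genCorrSet k G := by
  classical
  set P := T.image Prod.fst with hP
  let fib : S → Finset ℕ := fun a => (T.filter fun p => p.1 = a).image Prod.snd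
  have hinj : ∀ a, Set.InjOn Prod.snd (↑(T.filter fun p => p.1 = a) : Set (S × ℕ)) := by
    rintro a ⟨x, t⟩ hx ⟨y, u⟩ hy h
    simp only [Finset.coe_filter, Set.mem_ofPred_eq] at hx hy
    exact Prod.ext (hx.2.trans hy.2.symm) h
  have hprod : ∀ f : S × ℕ → ℤ, ∏ i : Fin P.card, ∏ j : Fin (fib (P.equivFin.symm i)).card,
      f (P.equivFin.symm i, (fib (P.equivFin.symm i)).orderEmbOfFin rfl j) = ∏ p ∈ T, f p := by
    intro f
    rw [Equiv.prod_comp P.equivFin.symm fun a : P =>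
      ∏ j : Fin (fib a).card, f (a, (fib a).orderEmbOfFin rfl j)]
    rw [Finset.prod_coe_sort P fun a => ∏ j : Fin (fib a).card, f (a, (fib a).orderEmbOfFin rfl j),
      ← Finset.prod_fiberwise_of_maps_to (g := Prod.fst) (t := P)
        (fun p hp => Finset.mem_image_of_mem _ hp)]
    refine Finset.prod_congr rfl fun a _ => ?_
    have h1 : ∏ j : Fin (fib a).card, f (a, (fib a).orderEmbOfFin rfl j)
        = ∏ t ∈ fib a, f (a, t) := by
      conv_rhs => rw [← Finset.image_orderEmbOfFin_univ (fib a) rfl]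
      rw [Finset.prod_image fun _ _ _ _ h => ((fib a).orderEmbOfFin rfl).injective h]
    rw [h1, Finset.prod_image (hinj a)]
    refine Finset.prod_congr rfl fun p hp => ?_
    rw [← (Finset.mem_filter.1 hp).2]
  have hmem : ∀ a, ∀ t ∈ fib a, (a, t) ∈ T := by
    intro a t ht
    obtain ⟨p, hp, rfl⟩ := Finset.mem_image.1 ht
    obtain ⟨hpT, rfl⟩ := Finset.mem_filter.1 hp
    exact hpT
  refine ⟨P.card, fun i => (fib (P.equivFin.symm i)).card, fun i => P.equivFin.symm i, M,
    fun i => (fib (P.equivFin.symm i)).orderEmbOfFin rfl, ?_, ?_, ?_, ?_, hM, ?_, ?_, ?_⟩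
  · rw [Nat.one_le_iff_ne_zero, Finset.card_ne_zero, hP, Finset.image_nonempty,
      ← Finset.card_pos]
    omega
  · intro i
    rw [Nat.one_le_iff_ne_zero, Finset.card_ne_zero, Finset.image_nonempty]
    obtain ⟨p, hp, hpi⟩ := Finset.mem_image.1 (P.equivFin.symm i).2
    exact ⟨p, Finset.mem_filter.2 ⟨hp, hpi⟩⟩
  · rw [Equiv.sum_comp P.equivFin.symm fun a : P => (fib a).card,
      Finset.sum_coe_sort P fun a => (fib a).card, ← hT,
      Finset.card_eq_sum_card_image Prod.fst T]
    exact Finset.sum_congr rfl fun a _ => Finset.card_image_of_injOn (hinj a)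
  · exact Subtype.val_injective.comp P.equivFin.symm.injective
  · exact fun i => ((fib (P.equivFin.symm i)).orderEmbOfFin rfl).strictMono
  · exact fun i j => hTN _ (hmem _ _ (Finset.orderEmbOfFin_mem _ rfl j))
  · congr 1
    exact Finset.sum_congr rfl fun n _ => (hprod fun p => seqAt (G p.1) (n + p.2)).symm

lemma exists_corrSum_of_mem {S : Type*} {N k v : ℕ} {G : S → Fin N → Bool}
    (hv : v ∈ genCorrSet k G) :
    ∃ (T : Finset (S × ℕ)) (M : ℕ), T.card = k ∧ 1 ≤ M ∧ (∀ p ∈ T, M + p.2 ≤ N) ∧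
      v = (corrSum T M G).natAbs := by
  classical
  obtain ⟨ℓ, κ, s, M, d, -, -, hκ, hs, hM, hd, hdN, rfl⟩ := hv
  have hinj : Function.Injective fun ij : (i : Fin ℓ) × Fin (κ i) => (s ij.1, d ij.1 ij.2) := by
    rintro ⟨i, j⟩ ⟨i', j'⟩ h
    obtain ⟨h1, h2⟩ := Prod.ext_iff.1 h
    obtain rfl := hs h1
    obtain rfl := (hd i).injective h2
    rfl
  refine ⟨Finset.univ.image fun ij : (i : Fin ℓ) × Fin (κ i) => (s ij.1, d ij.1 ij.2), M,
    ?_, hM, ?_, ?_⟩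
  · rw [Finset.card_image_of_injective _ hinj]
    simp [hκ]
  · intro p hp
    obtain ⟨⟨i, j⟩, -, rfl⟩ := Finset.mem_image.1 hp
    exact hdN i j
  · congr 1
    refine Finset.sum_congr rfl fun n _ => ?_
    rw [Finset.prod_image fun _ _ _ _ h => hinj h, Fintype.prod_sigma]

lemma bddAbove_genCorrSet {S : Type*} {N : ℕ} (k : ℕ) (hk : 1 ≤ k) (G : S → Fin N → Bool) :
    BddAbove (genCorrSet k G) := by
  refine ⟨N, fun v hv => ?_⟩
  obtain ⟨T, M, hT, -, hTN, rfl⟩ := exists_corrSum_of_mem hv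
  obtain ⟨p, hp⟩ := Finset.card_pos.1 (by omega : 0 < T.card)
  have := hTN p hp
  exact (natAbs_corrSum_le T M G).trans (by omega)

open Classical in
lemma card_exists_genCorr_ge_le {S : Type*} [Fintype S] {N k : ℕ} (hk : 1 ≤ k) {r : ℝ}
    (hr : 0 ≤ r) :
    ((Finset.univ.filter fun G : S → Fin N → Bool => ∃ v ∈ genCorrSet k G, r ≤ (v : ℝ)).card : ℝ)
      ≤ Fintype.card (S → Fin N → Bool) *
        ((Fintype.card S * N).choose k * N * (2 * Real.exp (-(r ^ 2 / (2 * N))))) := by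
  set w : ℝ := (Fintype.card (S → Fin N → Bool) : ℝ) with hw
  set I : Finset (Finset (S × ℕ) × ℕ) :=
    ((Finset.univ ×ˢ Finset.range N).powersetCard k ×ˢ Finset.Icc 1 N).filter
      fun i => ∀ p ∈ i.1, i.2 + p.2 ≤ N with hI
  have hsub : (Finset.univ.filter fun G : S → Fin N → Bool =>
      ∃ v ∈ genCorrSet k G, r ≤ (v : ℝ)) ⊆
      I.biUnion fun i => Finset.univ.filter fun G => r ≤ |(corrSum i.1 i.2 G : ℝ)| := by
    intro G hG
    obtain ⟨-, v, hv, hrv⟩ := Finset.mem_filter.1 hG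
    obtain ⟨T, M, hT, hM, hTN, rfl⟩ := exists_corrSum_of_mem hv
    have hle : ∀ p ∈ T, p.2 < N := fun p hp => by
      have := hTN p hp
      omega
    have hMN : M ≤ N := by
      obtain ⟨p, hp⟩ := Finset.card_pos.1 (by omega : 0 < T.card)
      have := hTN p hp
      omega
    refine Finset.mem_biUnion.2 ⟨(T, M), ?_, ?_⟩
    · simp only [hI, Finset.mem_filter, Finset.mem_product, Finset.mem_powersetCard,
        Finset.mem_Icc]
      refine ⟨⟨⟨fun p hp => ?_, hT⟩, hM, hMN⟩, hTN⟩
      simpa using hle p hp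
    · simpa [Nat.cast_natAbs] using hrv
  have hcard : (I.card : ℝ) ≤ (Fintype.card S * N).choose k * N := by
    have h1 : I.card ≤ (Fintype.card S * N).choose k * N := by
      refine (Finset.card_filter_le _ _).trans ?_
      simp
    exact_mod_cast h1
  calc _ ≤ ((I.biUnion fun i => Finset.univ.filter fun G : S → Fin N → Bool =>
          r ≤ |(corrSum i.1 i.2 G : ℝ)|).card : ℝ) := by
        exact_mod_cast Finset.card_le_card hsub
    _ ≤ ∑ i ∈ I, ((Finset.univ.filter fun G : S → Fin N → Bool =>
          r ≤ |(corrSum i.1 i.2 G : ℝ)|).card : ℝ) := by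
        exact_mod_cast Finset.card_biUnion_le
    _ ≤ ∑ i ∈ I, w * (2 * Real.exp (-(r ^ 2 / (2 * N)))) := by
        refine Finset.sum_le_sum fun i hi => ?_
        obtain ⟨T, M⟩ := i
        simp only [hI, Finset.mem_filter, Finset.mem_product, Finset.mem_powersetCard,
          Finset.mem_Icc] at hi
        obtain ⟨⟨⟨-, hT⟩, hM, hMN⟩, hTN⟩ := hi
        refine (card_corrSum_ge_le hM (Finset.card_pos.1 (by omega)) hTN hr).trans ?_
        have hM' : (0 : ℝ) < M := by exact_mod_cast hM
        have hMN' : (M : ℝ) ≤ N := by exact_mod_cast hMN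
        gcongr
    _ = I.card * (w * (2 * Real.exp (-(r ^ 2 / (2 * N))))) := by
        rw [Finset.sum_const, nsmul_eq_mul]
    _ ≤ ((Fintype.card S * N).choose k * N) * (w * (2 * Real.exp (-(r ^ 2 / (2 * N))))) := by
        gcongr
    _ = _ := by ring

open Classical in
lemma card_forall_genCorr_lt_le {S : Type*} [Fintype S] [Nonempty S] {N k m j : ℕ} (hk : 1 ≤ k)
    (hm : 1 ≤ m) (hmN : 2 * m ≤ N) (hjm : j ≤ m)
    (hkS : k - 1 ≤ (Fintype.card S - 1) * (N - 2 * m + 1)) :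
    ((Finset.univ.filter fun G : S → Fin N → Bool =>
        ∀ v ∈ genCorrSet k G, v < 2 * j).card : ℝ)
      ≤ Fintype.card (S → Fin N → Bool) /
        (((Fintype.card S - 1) * (N - 2 * m + 1)).choose (k - 1) *
          ((2 * m).choose (m + j) / 4 ^ m)) := by
  obtain ⟨s₀⟩ := ‹Nonempty S›
  set w : ℝ := (Fintype.card (S → Fin N → Bool) : ℝ) with hw
  have hw0 : 0 ≤ w := Nat.cast_nonneg _
  set A : Finset (S × ℕ) := (Finset.univ.erase s₀) ×ˢ Finset.range (N - 2 * m + 1) with hA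
  have hAcard : A.card = (Fintype.card S - 1) * (N - 2 * m + 1) := by
    simp [hA, Finset.card_erase_of_mem]
  have hA0 : (s₀, 0) ∉ A := by simp [hA]
  set F : Finset (Finset (S × ℕ)) := A.powersetCard (k - 1) with hF
  have hFcard : F.card = ((Fintype.card S - 1) * (N - 2 * m + 1)).choose (k - 1) := by
    rw [hF, Finset.card_powersetCard, hAcard]
  let fam : Finset (S × ℕ) → Finset (S × ℕ) := fun U => insert (s₀, 0) U
  have hsubA : ∀ U ∈ F, U ⊆ A := fun U hU => (Finset.mem_powersetCard.1 hU).1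
  have hnot : ∀ U ∈ F, (s₀, 0) ∉ U := fun U hU h => hA0 (hsubA U hU h)
  have hfamN : ∀ U ∈ F, ∀ p ∈ fam U, 2 * m + p.2 ≤ N := by
    intro U hU p hp
    rcases Finset.mem_insert.1 hp with rfl | hp
    · simpa using hmN
    · have := (Finset.mem_product.1 (hsubA U hU hp)).2
      rw [Finset.mem_range] at this
      omega
  have hfamcard : ∀ U ∈ F, (fam U).card = k := fun U hU => by
    rw [Finset.card_insert_of_notMem (hnot U hU), (Finset.mem_powersetCard.1 hU).2]
    omega
  have hfaminj : ∀ U ∈ F, ∀ U' ∈ F, U ≠ U' → fam U ≠ fam U' := by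
    intro U hU U' hU' hne h
    refine hne ?_
    rw [← Finset.erase_insert (hnot U hU), ← Finset.erase_insert (hnot U' hU')]
    exact congrArg (fun T => Finset.erase T (s₀, 0)) h
  have hseed : ∀ U ∈ F, seedPoly (fam U) s₀ = 1 := by
    intro U hU
    rw [seedPoly, Finset.sum_insert (hnot U hU), Finset.sum_eq_zero]
    · simp
    · intro p hp
      have := (Finset.mem_product.1 (hsubA U hU hp)).1
      rw [if_neg (Finset.ne_of_mem_erase this)]
  let ind : (Fin (2 * m) → ZMod 2) → ℝ := fun v => if (2 * j : ℤ) ≤ signSum v then 1 else 0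
  let f : Finset (S × ℕ) → (S → Fin N → Bool) → ℝ := fun U G => ind (corrWord (fam U) (2 * m) G)
  set p : ℝ := (∑ v, ind v) / 2 ^ (2 * m) with hp
  have h4 : (2 : ℝ) ^ (2 * m) = 4 ^ m := by rw [pow_mul]; norm_num
  have hple : ((2 * m).choose (m + j) / 4 ^ m : ℝ) ≤ p := by
    rw [hp, h4]
    gcongr
    simp only [ind, Finset.sum_boole]
    exact_mod_cast choose_le_card_signSum_ge m j
  have hchoose : (0 : ℝ) < (2 * m).choose (m + j) := by
    exact_mod_cast Nat.choose_pos (by omega)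
  have hp0 : 0 < p := lt_of_lt_of_le (by positivity) hple
  have hF0 : (0 : ℝ) < F.card := by
    rw [hFcard]
    exact_mod_cast Nat.choose_pos hkS
  have h1 : ∀ U ∈ F, ∑ G, f U G = p * w := by
    intro U hU
    have := sum_prod_corrWord _
      (shiftMap_unit_surjective (Finset.insert_nonempty _ _) (hfamN U hU)) fun _ v => ind v
    simp only [Finset.univ_unique, Finset.prod_singleton, Fintype.card_unit, pow_one] at this
    have h2 : ∑ G, f U G = ∑ G : S → Fin N → Bool, ind (corrWord (insert (s₀, 0) U) (2 * m) G) :=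
      rfl
    rw [hp, h2, div_mul_eq_mul_div, eq_div_iff (by positivity), mul_comm, this, mul_comm]
  have h2 : ∀ U ∈ F, ∀ U' ∈ F, U ≠ U' → ∑ G, f U G * f U' G = p ^ 2 * w := by
    intro U hU U' hU' hne
    have := sum_prod_corrWord _
      (shiftMap_bool_surjective s₀ (hfaminj U hU U' hU' hne) (hfamN U hU) (hfamN U' hU')
        (hseed U hU) (hseed U' hU')) fun _ v => ind v
    simp only [Fintype.prod_bool, Fintype.card_bool, if_true, Bool.false_eq_true, if_false] at this
    rw [hp, div_pow, div_mul_eq_mul_div, eq_div_iff (by positivity), mul_comm, sq (∑ v, ind v),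
      mul_comm (_ * _) w]
    exact this
  have h3 := card_avoid_le F f (fun U _ G => by simp only [f, ind]; split_ifs <;> simp)
    h1 h2 hp0 (Finset.card_pos.1 (by exact_mod_cast hF0))
    (Finset.univ.filter fun G : S → Fin N → Bool => ∀ v ∈ genCorrSet k G, v < 2 * j) (by
      intro G hG U hU
      have hlt := (Finset.mem_filter.1 hG).2 _
        (natAbs_corrSum_mem G hk (hfamcard U hU) (by omega) (hfamN U hU))
      simp only [f, ind]
      rw [if_neg]
      rw [← corrSum_eq_signSum]
      omega)
  refine h3.trans ?_
  rw [← hFcard]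
  gcongr

lemma four_pow_le_two_mul_sqrt_mul_centralBinom {m : ℕ} (hm : 1 ≤ m) :
    (4 : ℝ) ^ m ≤ 2 * Real.sqrt m * m.centralBinom := by
  have key : (16 : ℝ) ^ m ≤ 4 * m * (m.centralBinom : ℝ) ^ 2 := by
    induction m, hm using Nat.le_induction with
    | base => norm_num [Nat.centralBinom, Nat.choose]
    | succ m hm ih =>
      have h : ((m : ℝ) + 1) * (m + 1).centralBinom = 2 * (2 * m + 1) * m.centralBinom := by
        exact_mod_cast Nat.succ_mul_centralBinom_succ m
      have hm0 : (0 : ℝ) ≤ m := Nat.cast_nonneg m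
      set c : ℝ := (m.centralBinom : ℝ)
      set c' : ℝ := ((m + 1).centralBinom : ℝ)
      have hc' : c' = 2 * (2 * m + 1) * c / (m + 1) := by
        field_simp
        linarith
      push_cast
      have h2 : (16 : ℝ) * (4 * m * c ^ 2) ≤ 4 * (m + 1) * c' ^ 2 := by
        rw [hc', div_pow, mul_div_assoc', le_div_iff₀ (by positivity)]
        nlinarith [mul_nonneg (by positivity : 0 ≤ (m : ℝ) + 1) (sq_nonneg c)]
      calc (16 : ℝ) ^ (m + 1) = 16 * 16 ^ m := by ring
        _ ≤ 16 * (4 * m * c ^ 2) := by gcongr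
        _ ≤ _ := h2
  refine (sq_le_sq₀ (by positivity) (by positivity)).1 ?_
  rw [← pow_mul, mul_comm m 2, pow_mul]
  norm_num
  rw [mul_pow, mul_pow, Real.sq_sqrt (Nat.cast_nonneg m)]
  linarith

lemma factorial_mul_factorial_mul_pow_le {a m : ℕ} (h : a ≤ m) (i : ℕ) :
    (m + i).factorial * a.factorial * a ^ i ≤ (a + i).factorial * m.factorial * m ^ i := by
  induction i with
  | zero => simp [mul_comm]
  | succ i ih =>
    rw [← add_assoc, ← add_assoc, Nat.factorial_succ, Nat.factorial_succ]
    have h1 : (m + i + 1) * a ≤ (a + i + 1) * m := by nlinarith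
    calc (m + i + 1) * (m + i).factorial * a.factorial * a ^ (i + 1)
        = ((m + i + 1) * a) * ((m + i).factorial * a.factorial * a ^ i) := by ring
      _ ≤ ((a + i + 1) * m) * ((a + i).factorial * m.factorial * m ^ i) := Nat.mul_le_mul h1 ih
      _ = _ := by ring

lemma centralBinom_mul_pow_le {m j : ℕ} (h : j ≤ m) :
    m.centralBinom * (m - j) ^ j ≤ (2 * m).choose (m + j) * m ^ j := by
  have h1 := factorial_mul_factorial_mul_pow_le (Nat.sub_le m j) j
  rw [Nat.sub_add_cancel h] at h1
  have h2 : (2 * m).choose (m + j) * (m + j).factorial * (m - j).factorial = (2 * m).factorial := by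
    have := Nat.choose_mul_factorial_mul_factorial (show m + j ≤ 2 * m by omega)
    rwa [show 2 * m - (m + j) = m - j by omega] at this
  have h3 : m.centralBinom * m.factorial * m.factorial = (2 * m).factorial := by
    have := Nat.choose_mul_factorial_mul_factorial (show m ≤ 2 * m by omega)
    rwa [show 2 * m - m = m by omega] at this
  have h4 : 0 < (m + j).factorial * (m - j).factorial * (m.factorial * m.factorial) := by positivity
  refine le_of_mul_le_mul_right ?_ h4
  calc m.centralBinom * (m - j) ^ j *
        ((m + j).factorial * (m - j).factorial * (m.factorial * m.factorial))
      = (m.centralBinom * m.factorial * m.factorial) *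
        ((m + j).factorial * (m - j).factorial * (m - j) ^ j) := by ring
    _ ≤ (m.centralBinom * m.factorial * m.factorial) * (m.factorial * m.factorial * m ^ j) :=
        Nat.mul_le_mul_left _ h1
    _ = ((2 * m).choose (m + j) * (m + j).factorial * (m - j).factorial) *
        (m.factorial * m.factorial * m ^ j) := by rw [h2, h3]
    _ = _ := by ring

lemma neg_mul_log_two_le_log_one_sub {x : ℝ} (h0 : 0 ≤ x) (h1 : x ≤ 1 / 2) :
    -(2 * x * Real.log 2) ≤ Real.log (1 - x) := by
  have := strictConcaveOn_log_Ioi.concaveOn.2 (Set.mem_Ioi.2 one_pos)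
    (Set.mem_Ioi.2 (by norm_num : (0 : ℝ) < 1 / 2)) (by linarith : 0 ≤ 1 - 2 * x)
    (by linarith : 0 ≤ 2 * x) (by ring)
  simp only [smul_eq_mul, Real.log_one, mul_zero, zero_add, mul_one] at this
  rw [show 1 - 2 * x + 2 * x * (1 / 2) = 1 - x by ring, one_div, Real.log_inv] at this
  linarith

lemma log_choose_div_four_pow_ge {m j : ℕ} (hm : 1 ≤ m) (hj : 2 * j ≤ m) :
    -Real.log 2 - Real.log m / 2 - 2 * Real.log 2 * ((j : ℝ) ^ 2 / m) ≤
      Real.log ((2 * m).choose (m + j) / 4 ^ m) := by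
  have hm' : (0 : ℝ) < m := by exact_mod_cast hm
  have hj' : 2 * (j : ℝ) ≤ m := by exact_mod_cast hj
  have hc : (0 : ℝ) < m.centralBinom := by exact_mod_cast m.centralBinom_pos
  have hx : (j : ℝ) / m ≤ 1 / 2 := by rw [div_le_iff₀ hm']; linarith
  have h1 : (m.centralBinom : ℝ) * (1 - j / m) ^ j ≤ (2 * m).choose (m + j) := by
    have h := centralBinom_mul_pow_le (show j ≤ m by omega)
    have h' : (m.centralBinom : ℝ) * ((m : ℝ) - j) ^ j ≤ (2 * m).choose (m + j) * (m : ℝ) ^ j := by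
      rw [← Nat.cast_sub (show j ≤ m by omega)]
      exact_mod_cast h
    rw [show (1 : ℝ) - j / m = (m - j) / m by field_simp, div_pow, mul_div_assoc',
      div_le_iff₀ (by positivity)]
    exact h'
  have h2 : 1 / (2 * Real.sqrt m) * (1 - j / m) ^ j ≤ ((2 * m).choose (m + j) / 4 ^ m : ℝ) := by
    rw [le_div_iff₀ (by positivity)]
    have hpow : 0 ≤ (1 - (j : ℝ) / m) ^ j := pow_nonneg (by linarith) _
    calc 1 / (2 * Real.sqrt m) * (1 - j / m) ^ j * 4 ^ m
        ≤ 1 / (2 * Real.sqrt m) * (1 - j / m) ^ j * (2 * Real.sqrt m * m.centralBinom) := by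
          gcongr
          exact four_pow_le_two_mul_sqrt_mul_centralBinom hm
      _ = m.centralBinom * (1 - j / m) ^ j := by field_simp
      _ ≤ _ := h1
  have hpos : (0 : ℝ) < 1 - j / m := by linarith
  refine le_trans ?_ (Real.log_le_log (by positivity) h2)
  rw [Real.log_mul (by positivity) (by positivity), Real.log_pow, one_div, Real.log_inv,
    Real.log_mul (by norm_num) (by positivity), Real.log_sqrt hm'.le]
  have h3 := mul_le_mul_of_nonneg_left (neg_mul_log_two_le_log_one_sub (by positivity) hx)
    (Nat.cast_nonneg (α := ℝ) j)
  have h4 : (j : ℝ) * -(2 * (j / m) * Real.log 2) = -(2 * Real.log 2 * ((j : ℝ) ^ 2 / m)) := by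
    ring
  linarith

lemma div_pow_le_choose {n k : ℕ} (h : k ≤ n) : ((n : ℝ) / k) ^ k ≤ n.choose k := by
  induction k generalizing n with
  | zero => simp
  | succ k ih =>
    obtain ⟨n, rfl⟩ : ∃ n', n = n' + 1 := ⟨n - 1, by omega⟩
    have hkn : k ≤ n := by omega
    have h1 : ((n + 1 : ℕ) : ℝ) * n.choose k = (n + 1).choose (k + 1) * ((k + 1 : ℕ) : ℝ) := by
      exact_mod_cast Nat.add_one_mul_choose_eq n k
    have h2 : ((n + 1).choose (k + 1) : ℝ) = ((n + 1 : ℕ) : ℝ) / (k + 1 : ℕ) * n.choose k := by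
      field_simp
      linarith
    rw [h2, pow_succ, mul_comm]
    refine mul_le_mul_of_nonneg_left (le_trans ?_ (ih hkn)) (by positivity)
    rcases Nat.eq_zero_or_pos k with rfl | hk
    · simp
    · have hk' : (0 : ℝ) < k := by exact_mod_cast hk
      have hkn' : (k : ℝ) ≤ n := by exact_mod_cast hkn
      gcongr ?_ ^ k
      rw [div_le_div_iff₀ (by positivity) hk']
      push_cast
      nlinarith

lemma le_choose_of_pos_of_lt {n k : ℕ} (hk : 1 ≤ k) (hkn : k + 1 ≤ n) : n ≤ n.choose k := by
  induction n generalizing k with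
  | zero => omega
  | succ n ih =>
    obtain ⟨k, rfl⟩ : ∃ k', k = k' + 1 := ⟨k - 1, by omega⟩
    rw [Nat.choose_succ_succ']
    have h1 : 1 ≤ n.choose k := Nat.choose_pos (by omega)
    rcases Nat.lt_or_ge (k + 1) n with h | h
    · have := ih (k := k + 1) (by omega) h
      omega
    · obtain rfl : n = k + 1 := by omega
      simp [Nat.choose_succ_self_right]

lemma log_choose_le {n k : ℕ} (hk : 1 ≤ k) (hkn : k ≤ n) :
    Real.log (n.choose k) ≤ k * (1 + Real.log n - Real.log k) := by
  have hk' : (0 : ℝ) < k := by exact_mod_cast hk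
  have hn' : (0 : ℝ) < n := by exact_mod_cast hk.trans hkn
  have h1 : (n.choose k : ℝ) ≤ n ^ k * Real.exp k / k ^ k := by
    refine (Nat.choose_le_pow_div k n).trans ?_
    have h2 := Real.pow_div_factorial_le_exp (x := k) hk'.le k
    rw [div_le_div_iff₀ (by positivity) (by positivity), mul_assoc]
    rw [div_le_iff₀ (by positivity)] at h2
    gcongr
  have h3 : (0 : ℝ) < n.choose k := by exact_mod_cast Nat.choose_pos hkn
  refine (Real.log_le_log h3 h1).trans (le_of_eq ?_)
  rw [Real.log_div (by positivity) (by positivity), Real.log_mul (by positivity) (by positivity),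
    Real.log_exp, Real.log_pow, Real.log_pow]
  ring

/-- The quantity `log (N choose k) + k log F`, where `F` is the number of seeds. -/
noncomputable def logCount (N F k : ℕ) : ℝ := Real.log (N.choose k) + k * Real.log F

lemma exp_logCount {N F k : ℕ} (hF : 1 ≤ F) (hkN : k ≤ N) :
    Real.exp (logCount N F k) = N.choose k * (F : ℝ) ^ k := by
  have hF' : (0 : ℝ) < F := by exact_mod_cast hF
  have h3 : (0 : ℝ) < N.choose k := by exact_mod_cast Nat.choose_pos hkN
  rw [logCount, Real.exp_add, Real.exp_log h3, mul_comm (k : ℝ), Real.exp_mul, Real.exp_log hF',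
    Real.rpow_natCast]

lemma logCount_nonneg (N F k : ℕ) : 0 ≤ logCount N F k :=
  add_nonneg (Real.log_natCast_nonneg _)
    (mul_nonneg (Nat.cast_nonneg _) (Real.log_natCast_nonneg _))

lemma upper_union_bound {N F k : ℕ} (hF : 2 ≤ F) (hk : 2 ≤ k) (hkN : 6 * k ≤ N) :
    ((F * N).choose k * N *
      (2 * Real.exp (-((5 / 2 * Real.sqrt (N * logCount N F k)) ^ 2 / (2 * N)))) : ℝ)
      ≤ 2 / N * (3 / 10) ^ k := by
  have hN : (0 : ℝ) < N := by exact_mod_cast (by omega : 0 < N)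
  have hF' : (2 : ℝ) ≤ F := by exact_mod_cast hF
  have hkN' : 6 * (k : ℝ) ≤ N := by exact_mod_cast hkN
  set L := logCount N F k with hL
  have hL0 : 0 ≤ L := logCount_nonneg N F k
  have hexp : Real.exp L = N.choose k * (F : ℝ) ^ k := exp_logCount (by omega) (by omega)
  have h1 : (5 / 2 * Real.sqrt (N * L)) ^ 2 / (2 * N) = 25 / 8 * L := by
    rw [mul_pow, Real.sq_sqrt (by positivity)]
    field_simp
    ring
  have h2 : ((F * N).choose k : ℝ) ≤ (6 / 5) ^ k * Real.exp L := by
    have h3 := Nat.choose_le_pow_div (α := ℝ) k (F * N)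
    have h4 := Nat.pow_le_choose (α := ℝ) k N
    have h5 : (5 / 6 * N : ℝ) ≤ (N + 1 - k : ℕ) := by
      rw [Nat.cast_sub (by omega)]
      push_cast
      linarith
    rw [hexp]
    refine h3.trans ?_
    calc ((F * N : ℕ) : ℝ) ^ k / k.factorial
        = (6 / 5) ^ k * ((5 / 6 * N) ^ k / k.factorial * F ^ k) := by
          rw [show ((F * N : ℕ) : ℝ) = 6 / 5 * (5 / 6 * N * F) by push_cast; ring,
            mul_pow, mul_pow]
          ring
      _ ≤ (6 / 5) ^ k * (((N + 1 - k : ℕ) : ℝ) ^ k / k.factorial * F ^ k) := by gcongr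
      _ ≤ _ := by gcongr
  have h6 : (N : ℝ) * 2 ^ k ≤ Real.exp L := by
    rw [hexp]
    gcongr
    exact le_choose_of_pos_of_lt (by omega) (by omega)
  have h7 : Real.exp (-(25 / 8 * L)) ≤ (Real.exp L)⁻¹ ^ 3 := by
    rw [← Real.exp_neg, ← Real.exp_nat_mul]
    refine Real.exp_le_exp.2 ?_
    push_cast
    linarith
  rw [h1]
  have hE := Real.exp_pos L
  calc ((F * N).choose k * N * (2 * Real.exp (-(25 / 8 * L))) : ℝ)
      ≤ ((6 / 5) ^ k * Real.exp L) * N * (2 * (Real.exp L)⁻¹ ^ 3) := by gcongr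
    _ = 2 * N * (6 / 5) ^ k * (Real.exp L)⁻¹ ^ 2 := by field_simp
    _ ≤ 2 * N * (6 / 5) ^ k * ((N : ℝ) * 2 ^ k)⁻¹ ^ 2 := by gcongr
    _ = 2 / N * (3 / 10) ^ k := by
        rw [show (3 / 10 : ℝ) = 6 / 5 * (2 * 2)⁻¹ by norm_num, mul_pow, inv_pow (2 * 2 : ℝ), mul_pow]
        have hk2 : (2 : ℝ) ^ k ≠ 0 := by positivity
        generalize (2 : ℝ) ^ k = a at hk2
        generalize (6 / 5 : ℝ) ^ k = b
        field_simp

lemma logCount_le_linear {N F k : ℕ} (hk : 2 ≤ k) (hkN : 6 * k ≤ N)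
    (hFk : k * Real.log F ≤ N * Real.log 2 / 6) : logCount N F k ≤ 0.5834 * N := by
  have hk' : (0 : ℝ) < k := by exact_mod_cast (by omega : 0 < k)
  have hN : (0 : ℝ) < N := by exact_mod_cast (by omega : 0 < N)
  have h1 := log_choose_le (show 1 ≤ k by omega) (show k ≤ N by omega)
  have h2 : Real.log (N / (6 * k)) ≤ N / (6 * k) - 1 :=
    Real.log_le_sub_one_of_pos (by positivity)
  have h6 : Real.log 6 = Real.log 2 + Real.log 3 := by
    rw [← Real.log_mul (by norm_num) (by norm_num)]
    norm_num
  rw [Real.log_div (by positivity) (by positivity), Real.log_mul (by norm_num) (by positivity),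
    h6] at h2
  have h3 := mul_le_mul_of_nonneg_left h2 hk'.le
  have h4 : (k : ℝ) * (N / (6 * k) - 1) = N / 6 - k := by field_simp
  have hkN' : 6 * (k : ℝ) ≤ N := by exact_mod_cast hkN
  have h5 := mul_le_mul_of_nonneg_right hkN'
    (by linarith [Real.log_two_gt_d9, Real.log_three_gt_d9] : 0 ≤ Real.log 2 + Real.log 3)
  have h7 : (N : ℝ) * (2 * Real.log 2 + Real.log 3) ≤ N * 2.4851 := by
    gcongr
    linarith [Real.log_two_lt_d9, Real.log_three_lt_d9]
  rw [logCount]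
  nlinarith

lemma threshold_bounds {N F k m j : ℕ} (hN : 10000 ≤ N) (hk : 2 ≤ k) (hkN : 6 * k ≤ N)
    (hFk : k * Real.log F ≤ N * Real.log 2 / 6) (hm : m = 5 * N / 16)
    (hj : j = ⌊1 / 5 * Real.sqrt (N * logCount N F k)⌋₊ + 1) :
    2 * j ≤ m ∧ (j : ℝ) ^ 2 / m ≤ 0.128 * logCount N F k + 3 := by
  have hN' : (10000 : ℝ) ≤ N := by exact_mod_cast hN
  set L := logCount N F k with hL
  have hL0 : 0 ≤ L := logCount_nonneg N F k
  have hLN : L ≤ 0.5834 * N := logCount_le_linear hk hkN hFk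
  set h : ℝ := 1 / 5 * Real.sqrt (N * L) with hh
  have h0 : 0 ≤ h := by positivity
  have hsq : h ^ 2 = 0.04 * N * L := by
    rw [hh, mul_pow, Real.sq_sqrt (by positivity)]
    ring
  have hhN : h ≤ 0.153 * N := by
    refine (sq_le_sq₀ h0 (by positivity)).1 ?_
    rw [hsq]
    nlinarith
  have hjh : (j : ℝ) ≤ h + 1 := by
    rw [hj]
    push_cast
    linarith [Nat.floor_le h0]
  have hmN : 5 / 16 * (N : ℝ) - 1 ≤ m := by
    have : 5 * N ≤ 16 * m + 15 := by omega
    have : 5 * (N : ℝ) ≤ 16 * m + 15 := by exact_mod_cast this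
    linarith
  have hm0 : (0 : ℝ) < m := by linarith
  constructor
  · have : (2 * j : ℝ) ≤ m := by linarith
    exact_mod_cast this
  · rw [div_le_iff₀ hm0]
    have h1 : (j : ℝ) ^ 2 ≤ (h + 1) ^ 2 := by gcongr
    have h2 : (0.128 * L + 3) * (5 / 16 * (N : ℝ) - 1) ≤ (0.128 * L + 3) * m := by gcongr
    nlinarith

lemma lower_exponent_bound {N F k m j : ℕ} (hN : 10000 ≤ N) (hF : 2 ≤ F) (hk : 2 ≤ k)
    (hkN : 6 * k ≤ N) (hFk : k * Real.log F ≤ N * Real.log 2 / 6) (hm : m = 5 * N / 16)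
    (hj : j = ⌊1 / 5 * Real.sqrt (N * logCount N F k)⌋₊ + 1) :
    1 / 10 * Real.log N + 1 / 10 * k - 9 ≤
      Real.log (((F - 1) * (N - 2 * m + 1)).choose (k - 1) * ((2 * m).choose (m + j) / 4 ^ m)) := by
  obtain ⟨hjm, hjL⟩ := threshold_bounds hN hk hkN hFk hm hj
  set L := logCount N F k with hL
  have hk' : (2 : ℝ) ≤ k := by exact_mod_cast hk
  have hF' : (2 : ℝ) ≤ F := by exact_mod_cast hF
  have hN' : (10000 : ℝ) ≤ N := by exact_mod_cast hN
  have hkN' : 6 * (k : ℝ) ≤ N := by exact_mod_cast hkN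
  set A := (F - 1) * (N - 2 * m + 1) with hA
  have hA1 : 3 / 16 * (F * N : ℝ) ≤ A := by
    have e1 : (F : ℝ) / 2 ≤ (F - 1 : ℕ) := by
      rw [Nat.cast_sub (by omega)]
      push_cast
      linarith
    have e2 : 3 / 8 * (N : ℝ) ≤ (N - 2 * m + 1 : ℕ) := by
      have : 3 * N ≤ 8 * (N - 2 * m + 1) := by omega
      have : 3 * (N : ℝ) ≤ 8 * (N - 2 * m + 1 : ℕ) := by exact_mod_cast this
      linarith
    rw [hA, Nat.cast_mul]
    calc 3 / 16 * (F * N : ℝ) = F / 2 * (3 / 8 * N) := by ring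
      _ ≤ _ := by gcongr
  have hkA : (k : ℝ) ≤ A := by nlinarith
  have hkA' : k - 1 ≤ A := by
    have : k ≤ A := by exact_mod_cast hkA
    omega
  have hc1 : (0 : ℝ) < A.choose (k - 1) := by exact_mod_cast Nat.choose_pos hkA'
  have hc2 : (0 : ℝ) < (2 * m).choose (m + j) / 4 ^ m := by
    have : (0 : ℝ) < (2 * m).choose (m + j) := by exact_mod_cast Nat.choose_pos (by omega)
    positivity
  rw [Real.log_mul hc1.ne' hc2.ne']
  set Y : ℝ := Real.log F + Real.log N - Real.log k with hY
  have h16 : Real.log (3 / 16) = Real.log 3 - 4 * Real.log 2 := by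
    rw [Real.log_div (by norm_num) (by norm_num), show (16 : ℝ) = 2 ^ 4 by norm_num, Real.log_pow]
    norm_num
  have g1 : ((k : ℝ) - 1) * (Y + Real.log 3 - 4 * Real.log 2) ≤ Real.log (A.choose (k - 1)) := by
    have e1 : (3 / 16 * (F * N) / k : ℝ) ^ (k - 1) ≤ A.choose (k - 1) := by
      refine le_trans ?_ (div_pow_le_choose hkA')
      have : (0 : ℝ) < (k - 1 : ℕ) := by exact_mod_cast (by omega : 0 < k - 1)
      gcongr
      exact Nat.sub_le _ _
    have e2 := Real.log_le_log (by positivity) e1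
    rw [Real.log_pow, Real.log_div (by positivity) (by positivity),
      Real.log_mul (by norm_num) (by positivity), Real.log_mul (by positivity) (by positivity),
      Nat.cast_sub (by omega), h16] at e2
    push_cast at e2
    refine le_trans (le_of_eq ?_) e2
    rw [hY]
    ring
  have hm1 : 1 ≤ m := by omega
  have g2 := log_choose_div_four_pow_ge hm1 hjm
  have g3 : Real.log m ≤ Real.log N :=
    Real.log_le_log (by exact_mod_cast hm1) (by exact_mod_cast (by omega : m ≤ N))
  have l2 := Real.log_two_lt_d9
  have l2' := Real.log_two_gt_d9
  have l3 := Real.log_three_lt_d9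
  have l3' := Real.log_three_gt_d9
  have hL0 : 0 ≤ L := logCount_nonneg N F k
  have g4 : 2 * Real.log 2 * ((j : ℝ) ^ 2 / m) ≤ 0.18 * L + 4.2 := by
    calc 2 * Real.log 2 * ((j : ℝ) ^ 2 / m) ≤ 1.39 * (0.128 * L + 3) := by
          gcongr
          linarith
      _ ≤ _ := by linarith
  have g5 : L ≤ k * (1 + Y) := by
    have := log_choose_le (show 1 ≤ k by omega) (show k ≤ N by omega)
    rw [hL, logCount, hY]
    linarith
  have hYlow : 2 * Real.log 2 + Real.log 3 ≤ Y := by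
    have e1 : Real.log 6 + Real.log k ≤ Real.log N := by
      rw [← Real.log_mul (by norm_num) (by positivity)]
      exact Real.log_le_log (by positivity) hkN'
    have e2 : Real.log 6 = Real.log 2 + Real.log 3 := by
      rw [← Real.log_mul (by norm_num) (by norm_num)]
      norm_num
    have e3 : Real.log 2 ≤ Real.log F := Real.log_le_log (by norm_num) hF'
    rw [hY]
    linarith
  have g6 : 0 ≤ ((k : ℝ) - 2) * (0.82 * Y + Real.log 3 - 4 * Real.log 2 - 0.18 - 0.18) :=
    mul_nonneg (by linarith) (by linarith)
  have g7 : Real.log k ≤ k / 10 + 2 := by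
    have e1 : Real.log (k / 10) ≤ k / 10 - 1 := Real.log_le_sub_one_of_pos (by positivity)
    have e2 : Real.log 10 ≤ 3 := by
      have e3 : Real.log 10 ≤ Real.log (2 ^ 4) := Real.log_le_log (by norm_num) (by norm_num)
      rw [Real.log_pow] at e3
      norm_num at e3
      linarith
    rw [Real.log_div (by positivity) (by norm_num)] at e1
    linarith
  have g8 : Real.log N - Real.log k ≤ Y := by
    rw [hY]
    linarith [Real.log_nonneg (by linarith : (1 : ℝ) ≤ F)]
  have g9 : 0 ≤ Real.log N := Real.log_nonneg (by linarith)
  nlinarith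

lemma exists_failure_bound_lt {ε : ℝ} (hε : 0 < ε) : ∃ N₀ : ℕ, ∀ N : ℕ, N₀ < N → 10000 ≤ N ∧
    (Real.exp 9 * Real.exp (-(1 / 10 * Real.log N)) + 2 / N) * (1 - Real.exp (-(1 / 10)))⁻¹ ≤ ε := by
  have h1 : Filter.Tendsto (fun N : ℕ => Real.exp (-(1 / 10 * Real.log N))) Filter.atTop
      (nhds 0) :=
    Real.tendsto_exp_neg_atTop_nhds_zero.comp
      ((Real.tendsto_log_atTop.comp tendsto_natCast_atTop_atTop).const_mul_atTop (by norm_num))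
  have h2 : Filter.Tendsto (fun N : ℕ => (Real.exp 9 * Real.exp (-(1 / 10 * Real.log N)) + 2 / N) *
      (1 - Real.exp (-(1 / 10)))⁻¹) Filter.atTop (nhds 0) := by
    have := ((h1.const_mul (Real.exp 9)).add
      (tendsto_const_div_atTop_nhds_zero_nat (2 : ℝ))).mul_const (1 - Real.exp (-(1 / 10)))⁻¹
    simpa using this
  obtain ⟨N₀, hN₀⟩ := Filter.eventually_atTop.1
    ((h2.eventually_le_const hε).and (Filter.eventually_ge_atTop 10000))
  exact ⟨N₀, fun N hN => ⟨(hN₀ N hN.le).2, (hN₀ N hN.le).1⟩⟩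

/-- For every `ε > 0` there is `N₀` such that for `N > N₀` and every finite seed set `𝒮`
with `1 ≤ log₂|𝒮| < N/12`, a random generator `G : 𝒮 → {-1,1}^N` (all entries independent
uniform `±1`, i.e. `G` uniform among all maps) satisfies, with probability at least `1 - ε`,
`(2/5)·√(N(log C(N,k) + k log|𝒮|)) < Φ̃ₖ(G) < (5/2)·√(N(log C(N,k) + k log|𝒮|))`
for every `k` with `2 ≤ k ≤ N/(6 log₂|𝒮|)`. -/
theorem typical_cross_correlation_generator :
    ∀ ε : ℝ, 0 < ε → ∃ N₀ : ℕ, ∀ N : ℕ, N₀ < N →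
    ∀ (S : Type) [Fintype S],
      1 ≤ Real.logb 2 (Fintype.card S) →
      Real.logb 2 (Fintype.card S) < (N : ℝ) / 12 →
    (1 - ε) * (Nat.card (S → Fin N → Bool) : ℝ) ≤
      ({G : S → Fin N → Bool |
        ∀ k : ℕ, 2 ≤ k → (k : ℝ) ≤ (N : ℝ) / (6 * Real.logb 2 (Fintype.card S)) →
          (2/5) * Real.sqrt ((N : ℝ) *
              (Real.log (N.choose k) + k * Real.log (Fintype.card S))) < (genCrossCorr k G : ℝ) ∧
          (genCrossCorr k G : ℝ) < (5/2) * Real.sqrt ((N : ℝ) *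
              (Real.log (N.choose k) + k * Real.log (Fintype.card S)))}.ncard : ℝ) := by
  intro ε hε
  obtain ⟨N₀, hN₀⟩ := exists_failure_bound_lt hε
  refine ⟨N₀, fun N hN S _ hlog _ => ?_⟩
  classical
  obtain ⟨hNbig, hη⟩ := hN₀ N hN
  set F := Fintype.card S with hF
  have hNpos : (0 : ℝ) < N := by exact_mod_cast (by omega : 0 < N)
  have hF2 : 2 ≤ F := by
    by_contra h
    have hF1 : F = 0 ∨ F = 1 := by omega
    rcases hF1 with h | h <;> norm_num [h] at hlog
  have : Nonempty S := Fintype.card_pos_iff.1 (by omega)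
  have hrange : ∀ k : ℕ, (k : ℝ) ≤ (N : ℝ) / (6 * Real.logb 2 F) →
      6 * k ≤ N ∧ k * Real.log F ≤ N * Real.log 2 / 6 := by
    intro k hk
    rw [le_div_iff₀ (by linarith)] at hk
    have hk0 : (0 : ℝ) ≤ k := Nat.cast_nonneg k
    constructor
    · have : 6 * (k : ℝ) ≤ N := by nlinarith
      exact_mod_cast this
    · have hl2 : 0 < Real.log 2 := Real.log_pos (by norm_num)
      have h := mul_le_mul_of_nonneg_right hk hl2.le
      rw [Real.logb] at h
      have h' : (k : ℝ) * (6 * (Real.log F / Real.log 2)) * Real.log 2 = 6 * (k * Real.log F) := by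
        field_simp
      linarith
  set w : ℝ := (Fintype.card (S → Fin N → Bool) : ℝ) with hw
  have hw0 : 0 ≤ w := Nat.cast_nonneg _
  set r : ℝ := Real.exp (-(1 / 10)) with hr
  set η : ℝ := Real.exp 9 * Real.exp (-(1 / 10 * Real.log N)) + 2 / N with hηdef
  set K := (Finset.range (N + 1)).filter fun k : ℕ =>
    2 ≤ k ∧ (k : ℝ) ≤ (N : ℝ) / (6 * Real.logb 2 F) with hK
  let j : ℕ → ℕ := fun k => ⌊1 / 5 * Real.sqrt (N * logCount N F k)⌋₊ + 1
  let U : ℕ → Finset (S → Fin N → Bool) := fun k => Finset.univ.filter fun G =>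
    ∃ v ∈ genCorrSet k G, 5 / 2 * Real.sqrt (N * logCount N F k) ≤ (v : ℝ)
  let V : ℕ → Finset (S → Fin N → Bool) := fun k => Finset.univ.filter fun G =>
    ∀ v ∈ genCorrSet k G, v < 2 * j k
  have hUV : ∀ k ∈ K, (((U k ∪ V k).card : ℕ) : ℝ) ≤ w * (η * r ^ k) := by
    intro k hk
    obtain ⟨hk2, hkr⟩ := (Finset.mem_filter.1 hk).2
    obtain ⟨hkN, hkF⟩ := hrange k hkr
    have hrk : r ^ k = Real.exp (-(1 / 10 * k)) := by
      rw [hr, ← Real.exp_nat_mul]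
      ring_nf
    have h1 : ((U k).card : ℝ) ≤ w * (2 / N * r ^ k) := by
      refine (card_exists_genCorr_ge_le (by omega) (by positivity)).trans ?_
      refine mul_le_mul_of_nonneg_left ((upper_union_bound hF2 hk2 hkN).trans ?_) hw0
      have : (3 / 10 : ℝ) ≤ r := by
        have := Real.add_one_le_exp (-(1 / 10) : ℝ)
        rw [hr]
        linarith
      gcongr
    have h2 : ((V k).card : ℝ) ≤ w * (Real.exp 9 * Real.exp (-(1 / 10 * Real.log N)) * r ^ k) := by
      obtain ⟨hjm, -⟩ := threshold_bounds hNbig hk2 hkN hkF rfl (rfl : j k = _)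
      have hexp := lower_exponent_bound hNbig hF2 hk2 hkN hkF rfl (rfl : j k = _)
      set m := 5 * N / 16 with hm
      have hkA : k - 1 ≤ (F - 1) * (N - 2 * m + 1) :=
        le_trans (by omega : k - 1 ≤ 1 * (N - 2 * m + 1))
          (Nat.mul_le_mul_right _ (by omega : 1 ≤ F - 1))
      refine (card_forall_genCorr_lt_le (by omega) (by omega : 1 ≤ m) (by omega) (by omega)
        hkA).trans ?_
      have hc1 : (0 : ℝ) < ((F - 1) * (N - 2 * m + 1)).choose (k - 1) := by
        exact_mod_cast Nat.choose_pos hkA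
      have hc2 : (0 : ℝ) < (2 * m).choose (m + j k) := by
        exact_mod_cast Nat.choose_pos (by omega)
      rw [div_eq_mul_inv]
      refine mul_le_mul_of_nonneg_left ?_ hw0
      rw [hrk, ← Real.exp_add, ← Real.exp_add, ← Real.exp_log (inv_pos.2 (by positivity)),
        Real.log_inv]
      exact Real.exp_le_exp.2 (by linarith)
    calc (((U k ∪ V k).card : ℕ) : ℝ) ≤ (U k).card + (V k).card := by
          exact_mod_cast Finset.card_union_le _ _
      _ ≤ _ := add_le_add h1 h2
      _ = w * (η * r ^ k) := by rw [hηdef]; ring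
  have hr1 : r < 1 := Real.exp_lt_one_iff.2 (by norm_num)
  have hr0 : 0 ≤ r := (Real.exp_pos _).le
  have hη0 : 0 ≤ η := by positivity
  set bad := K.biUnion fun k => U k ∪ V k with hbad
  have hbadcard : (bad.card : ℝ) ≤ w * ε := by
    calc (bad.card : ℝ) ≤ ∑ k ∈ K, (((U k ∪ V k).card : ℕ) : ℝ) := by
          exact_mod_cast Finset.card_biUnion_le
      _ ≤ ∑ k ∈ K, w * (η * r ^ k) := Finset.sum_le_sum hUV
      _ = w * (η * ∑ k ∈ K, r ^ k) := by simp only [Finset.mul_sum]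
      _ ≤ w * (η * (1 - r)⁻¹) := by
          gcongr
          rw [← tsum_geometric_of_lt_one hr0 hr1]
          exact (summable_geometric_of_lt_one hr0 hr1).sum_le_tsum _ fun k _ => pow_nonneg hr0 k
      _ ≤ w * ε := by gcongr
  have hsub : (↑(Finset.univ \ bad) : Set (S → Fin N → Bool)) ⊆ {G : S → Fin N → Bool |
        ∀ k : ℕ, 2 ≤ k → (k : ℝ) ≤ (N : ℝ) / (6 * Real.logb 2 F) →
          (2/5) * Real.sqrt ((N : ℝ) *
              (Real.log (N.choose k) + k * Real.log F)) < (genCrossCorr k G : ℝ) ∧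
          (genCrossCorr k G : ℝ) < (5/2) * Real.sqrt ((N : ℝ) *
              (Real.log (N.choose k) + k * Real.log F))} := by
    intro G hG k hk2 hkr
    obtain ⟨hkN, hkF⟩ := hrange k hkr
    have hkK : k ∈ K := by
      rw [hK, Finset.mem_filter, Finset.mem_range]
      exact ⟨by omega, hk2, hkr⟩
    have hGnot : G ∉ U k ∪ V k := fun h => by
      simp only [Finset.coe_sdiff, Finset.coe_univ, Set.mem_sdiff, Finset.mem_coe] at hG
      exact hG.2 (Finset.mem_biUnion.2 ⟨k, hkK, h⟩)
    simp only [U, V, Finset.mem_union, Finset.mem_filter, Finset.mem_univ, true_and, not_or,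
      not_exists, not_and, not_forall, not_le, not_lt] at hGnot
    obtain ⟨hU, v, hv, hvj⟩ := hGnot
    have hbdd := bddAbove_genCorrSet k (by omega) G
    constructor
    · have h1 : v ≤ genCrossCorr k G := le_csSup hbdd hv
      have h2 : ((2 * j k : ℕ) : ℝ) ≤ genCrossCorr k G := by exact_mod_cast hvj.trans h1
      have h3 := Nat.lt_floor_add_one (1 / 5 * Real.sqrt (N * logCount N F k))
      change 2 / 5 * Real.sqrt (N * logCount N F k) < _
      simp only [j] at h2
      push_cast at h2
      linarith
    · exact hU _ (Nat.sSup_mem ⟨v, hv⟩ hbdd)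
  have hncard : ((Finset.univ \ bad).card : ℝ) ≤ _ :=
    Nat.cast_le.2 ((Set.ncard_coe_finset _).symm.le.trans (Set.ncard_le_ncard hsub (Set.toFinite _)))
  refine le_trans ?_ hncard
  have hsum : ((Finset.univ \ bad).card : ℝ) = w - bad.card := by
    rw [Finset.card_sdiff_of_subset (Finset.subset_univ _),
      Nat.cast_sub (Finset.card_le_card (Finset.subset_univ _)),
      Finset.card_univ]
  rw [hsum, Nat.card_eq_fintype_card]
  linarith
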